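/- Let k_1, k_2 ≥ 0 and suppose the type II multiple orthogonal polynomial P_{k_1,k_2} and the type I multiple orthogonal functions Q_{k_1+1,k_2} = A_{k_1+1,k_2}(x) e^{a_1 x} + B_{k_1+1,k_2}(x) e^{a_2 x} and Q_{k_1,k_2+1} = A_{k_1,k_2+1}(x) e^{a_1 x} + B_{k_1,k_2+1}(x) e^{a_2 x} exist. Then (coefficient of x^{k_1} in A_{k_1+1,k_2}) · h^{(1)}_{k_1,k_2} = 1 and (coefficient of x^{k_2} in B_{k_1,k_2+1}) · h^{(2)}_{k_1,k_2} = 1; in particular h^{(1)}_{k_1,k_2} ≠ 0 and h^{(2)}_{k_1,k_2} ≠ 0. -/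

import Mathlib

open MeasureTheory

/-- The weight `w(x) = e^{-(V(x) - a x)}`. -/
noncomputable def wgt (V : ℝ → ℝ) (a x : ℝ) : ℝ := Real.exp (-(V x - a * x))

/-- The function `A(x) e^{a₁ x} + B(x) e^{a₂ x}` built from two polynomials. -/
noncomputable def typeIFun (a₁ a₂ : ℝ) (A B : Polynomial ℝ) (x : ℝ) : ℝ :=
  Polynomial.eval x A * Real.exp (a₁ * x) + Polynomial.eval x B * Real.exp (a₂ * x)

/-- `P` is the type II multiple orthogonal polynomial `P_{k₁,k₂}`: monic of degree
`k₁ + k₂`, with `kⱼ` orthogonality conditions with respect to `wⱼ`, `j = 1, 2`. -/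
structure IsTypeII (V : ℝ → ℝ) (a₁ a₂ : ℝ) (k₁ k₂ : ℕ) (P : Polynomial ℝ) : Prop where
  monic : P.Monic
  natDeg : P.natDegree = k₁ + k₂
  orth₁ : ∀ i : ℕ, i < k₁ → (∫ x : ℝ, Polynomial.eval x P * x ^ i * wgt V a₁ x) = 0
  orth₂ : ∀ i : ℕ, i < k₂ → (∫ x : ℝ, Polynomial.eval x P * x ^ i * wgt V a₂ x) = 0

/-- `(A, B)` gives the type I multiple orthogonal function
`Q_{k₁,k₂}(x) = A(x) e^{a₁ x} + B(x) e^{a₂ x}`, where `deg A ≤ k₁ - 1`,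
`deg B ≤ k₂ - 1`, `∫ x^j Q(x) e^{-V(x)} dx = 0` for `j = 0, …, k₁ + k₂ - 2`
and `= 1` for `j = k₁ + k₂ - 1`. -/
structure IsTypeI (V : ℝ → ℝ) (a₁ a₂ : ℝ) (k₁ k₂ : ℕ) (A B : Polynomial ℝ) : Prop where
  degA : A.degree < (k₁ : WithBot ℕ)
  degB : B.degree < (k₂ : WithBot ℕ)
  orth : ∀ j : ℕ, j + 1 < k₁ + k₂ →
    (∫ x : ℝ, x ^ j * typeIFun a₁ a₂ A B x * Real.exp (-(V x))) = 0
  norm : (∫ x : ℝ, x ^ (k₁ + k₂ - 1) * typeIFun a₁ a₂ A B x * Real.exp (-(V x))) = 1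

/-- The number `h^{(j)}_{k₁,k₂} = ∫ P_{k₁,k₂}(x) x^{k_j} w_j(x) dx`; here `a = a_j`
and `k = k_j`, and `P` should be the polynomial `P_{k₁,k₂}`. -/
noncomputable def hNum (V : ℝ → ℝ) (a : ℝ) (k : ℕ) (P : Polynomial ℝ) : ℝ :=
  ∫ x : ℝ, Polynomial.eval x P * x ^ k * wgt V a x

theorem integral_mul_eval_eq_coeff_mul {f : ℝ → ℝ} {k : ℕ} {A : Polynomial ℝ}
    (hA : A.degree < ((k + 1 : ℕ) : WithBot ℕ))
    (hf : ∀ i : ℕ, Integrable fun x => f x * x ^ i)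
    (horth : ∀ i < k, ∫ x, f x * x ^ i = 0) :
    ∫ x, f x * A.eval x = A.coeff k * ∫ x, f x * x ^ k := by
  have hexp (x : ℝ) :
      f x * A.eval x = ∑ i ∈ Finset.range (k + 1), A.coeff i * (f x * x ^ i) := by
    rw [Polynomial.eval_eq_sum_range' (n := k + 1), Finset.mul_sum]
    · exact Finset.sum_congr rfl fun i _ => by ring
    · rcases eq_or_ne A 0 with rfl | h0
      · simp
      · exact (Polynomial.natDegree_lt_iff_degree_lt h0).2 hA
  simp_rw [hexp]
  rw [integral_finsetSum _ fun i _ => (hf i).const_mul _, Finset.sum_range_succ,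
    integral_const_mul, Finset.sum_eq_zero, zero_add]
  intro i hi
  rw [integral_const_mul, horth i (Finset.mem_range.1 hi), mul_zero]

theorem integrable_eval_mul_wgt {V : ℝ → ℝ} (hV : Continuous V)
    (hVint : ∀ (a : ℝ) (k : ℕ),
      Integrable (fun x : ℝ => |x| ^ k * Real.exp (-(V x - a * x))))
    (a : ℝ) (p : Polynomial ℝ) : Integrable fun x => p.eval x * wgt V a x := by
  simp_rw [Polynomial.eval_eq_sum_range, Finset.sum_mul, mul_assoc]
  refine integrable_finsetSum _ fun i _ => Integrable.const_mul ?_ _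
  refine (hVint a i).mono ?_ (Filter.Eventually.of_forall fun x => ?_)
  · unfold wgt
    exact Continuous.aestronglyMeasurable (by fun_prop)
  · simp [wgt]

theorem typeIFun_mul_exp (V : ℝ → ℝ) (a₁ a₂ : ℝ) (A B : Polynomial ℝ) (x : ℝ) :
    typeIFun a₁ a₂ A B x * Real.exp (-(V x)) =
      A.eval x * wgt V a₁ x + B.eval x * wgt V a₂ x := by
  have h (a : ℝ) : wgt V a x = Real.exp (a * x) * Real.exp (-(V x)) := by
    rw [wgt, ← Real.exp_add]
    congr 1
    ring
  rw [typeIFun, h, h]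
  ring

/-- Pairing the type II polynomial with a function `A(x) e^{a₁ x} + B(x) e^{a₂ x}` of the next
total degree leaves only the leading terms on both sides. -/
theorem IsTypeII.coeff_mul_hNum_add {V : ℝ → ℝ} (hV : Continuous V)
    (hVint : ∀ (a : ℝ) (k : ℕ),
      Integrable (fun x : ℝ => |x| ^ k * Real.exp (-(V x - a * x))))
    {a₁ a₂ : ℝ} {k₁ k₂ : ℕ} {P A B : Polynomial ℝ} (hP : IsTypeII V a₁ a₂ k₁ k₂ P)
    (hA : A.degree < ((k₁ + 1 : ℕ) : WithBot ℕ)) (hB : B.degree < ((k₂ + 1 : ℕ) : WithBot ℕ))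
    (horth : ∀ j < k₁ + k₂, ∫ x, x ^ j * typeIFun a₁ a₂ A B x * Real.exp (-(V x)) = 0) :
    A.coeff k₁ * hNum V a₁ k₁ P + B.coeff k₂ * hNum V a₂ k₂ P =
      ∫ x, x ^ (k₁ + k₂) * typeIFun a₁ a₂ A B x * Real.exp (-(V x)) := by
  have hint := integrable_eval_mul_wgt hV hVint
  have hQ (j : ℕ) (x : ℝ) : typeIFun a₁ a₂ A B x * Real.exp (-(V x)) * x ^ j =
      x ^ j * typeIFun a₁ a₂ A B x * Real.exp (-(V x)) := by ring
  have hPw (a : ℝ) (j : ℕ) (x : ℝ) :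
      P.eval x * wgt V a x * x ^ j = P.eval x * x ^ j * wgt V a x := by ring
  have hPint (a : ℝ) (j : ℕ) : Integrable fun x => P.eval x * wgt V a x * x ^ j := by
    refine (hint a (P * Polynomial.X ^ j)).congr (Filter.Eventually.of_forall fun x => ?_)
    simp only [hPw, Polynomial.eval_mul, Polynomial.eval_pow, Polynomial.eval_X]
  have h₁ := integral_mul_eval_eq_coeff_mul hA (hPint a₁)
    (by simpa only [hPw] using hP.orth₁)
  have h₂ := integral_mul_eval_eq_coeff_mul hB (hPint a₂)
    (by simpa only [hPw] using hP.orth₂)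
  have hPdeg : P.degree < ((k₁ + k₂ + 1 : ℕ) : WithBot ℕ) := by
    rw [Polynomial.degree_eq_natDegree hP.monic.ne_zero, hP.natDeg]
    exact_mod_cast Nat.lt_succ_self _
  have h₃ := integral_mul_eval_eq_coeff_mul
    (f := fun x => typeIFun a₁ a₂ A B x * Real.exp (-(V x))) hPdeg
    (fun j => by
      refine ((hint a₁ (A * Polynomial.X ^ j)).add (hint a₂ (B * Polynomial.X ^ j))).congr
        (Filter.Eventually.of_forall fun x => ?_)
      simp only [Pi.add_apply, Polynomial.eval_mul, Polynomial.eval_pow, Polynomial.eval_X,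
        typeIFun_mul_exp]
      ring)
    (by simpa only [hQ] using horth)
  have hlead : P.coeff (k₁ + k₂) = 1 := by rw [← hP.natDeg]; exact hP.monic.coeff_natDegree
  simp only [hlead, one_mul, hQ] at h₃
  simp only [hPw] at h₁ h₂
  rw [hNum, hNum, ← h₁, ← h₂, ← h₃, ← integral_add]
  · refine integral_congr_ae (Filter.Eventually.of_forall fun x => ?_)
    simp only [typeIFun_mul_exp]
    ring
  · refine (hint a₁ (P * A)).congr (Filter.Eventually.of_forall fun x => ?_)
    simp only [Polynomial.eval_mul]
    ring
  · refine (hint a₂ (P * B)).congr (Filter.Eventually.of_forall fun x => ?_)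
    simp only [Polynomial.eval_mul]
    ring

theorem statement_17 (V : ℝ → ℝ) (hV : Continuous V)
    (hVint : ∀ (a : ℝ) (k : ℕ),
      Integrable (fun x : ℝ => |x| ^ k * Real.exp (-(V x - a * x))))
    (a₁ a₂ : ℝ) (ha : a₁ ≠ a₂)
    (k₁ k₂ : ℕ)
    (P : Polynomial ℝ) (hP : IsTypeII V a₁ a₂ k₁ k₂ P)
    -- the type I function `Q_{k₁+1,k₂}`
    (A₁ B₁ : Polynomial ℝ) (hQ₁ : IsTypeI V a₁ a₂ (k₁ + 1) k₂ A₁ B₁)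
    -- the type I function `Q_{k₁,k₂+1}`
    (A₂ B₂ : Polynomial ℝ) (hQ₂ : IsTypeI V a₁ a₂ k₁ (k₂ + 1) A₂ B₂) :
    A₁.coeff k₁ * hNum V a₁ k₁ P = 1 ∧
    B₂.coeff k₂ * hNum V a₂ k₂ P = 1 ∧
    hNum V a₁ k₁ P ≠ 0 ∧ hNum V a₂ k₂ P ≠ 0 := by
  have h₁ : A₁.coeff k₁ * hNum V a₁ k₁ P = 1 := by
    have h := hP.coeff_mul_hNum_add hV hVint hQ₁.degA
      (hQ₁.degB.trans (by exact_mod_cast Nat.lt_succ_self _))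
      (fun j hj => hQ₁.orth j (by omega))
    have hnorm := hQ₁.norm
    rw [show k₁ + 1 + k₂ - 1 = k₁ + k₂ by omega] at hnorm
    rwa [Polynomial.coeff_eq_zero_of_degree_lt hQ₁.degB, zero_mul, add_zero, hnorm] at h
  have h₂ : B₂.coeff k₂ * hNum V a₂ k₂ P = 1 := by
    have h := hP.coeff_mul_hNum_add hV hVint
      (hQ₂.degA.trans (by exact_mod_cast Nat.lt_succ_self _)) hQ₂.degB
      (fun j hj => hQ₂.orth j (by omega))
    have hnorm := hQ₂.norm
    rw [show k₁ + (k₂ + 1) - 1 = k₁ + k₂ by omega] at hnorm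
    rwa [Polynomial.coeff_eq_zero_of_degree_lt hQ₂.degA, zero_mul, zero_add, hnorm] at h
  exact ⟨h₁, h₂, right_ne_zero_of_mul_eq_one h₁, right_ne_zero_of_mul_eq_one h₂⟩
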